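/- Suppose −1 ≤ a < 1/4. Then ζ(θ) = ((2a − 1)cos θ + √((1 − 4a)cos²θ + a)) / (1 − 4a·cos²θ) satisfies ζ(θ) → (1 − 2a + √(1 − 3a))/(1 − 4a) ≥ 1 as θ → π⁻, and for every m ∈ ℕ the function g_m(θ) = (ζ(θ) − cos θ)·sin((m+1)θ)/sin θ − cos((m+1)θ) + 1/ζ(θ)^{m+1} has a limit as θ → π⁻ whose sign is (−1)^m, i.e. (−1)^m · lim_{θ→π⁻} g_m(θ) > 0. -/

import Mathlib

open Filter Topology

/-- `ζ(θ)` from the paper. -/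
noncomputable def zetaFn (a θ : ℝ) : ℝ :=
  ((2 * a - 1) * Real.cos θ + Real.sqrt ((1 - 4 * a) * Real.cos θ ^ 2 + a)) /
    (1 - 4 * a * Real.cos θ ^ 2)

/-- `g_m(θ)` from the paper. -/
noncomputable def gFn (a : ℝ) (m : ℕ) (θ : ℝ) : ℝ :=
  (zetaFn a θ - Real.cos θ) * Real.sin ((m + 1) * θ) / Real.sin θ -
    Real.cos ((m + 1) * θ) + 1 / (zetaFn a θ) ^ (m + 1)

/-- If `-1 ≤ a < 1/4` then `ζ(θ) → (1 - 2a + √(1 - 3a))/(1 - 4a) ≥ 1` as `θ → π⁻`, and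
for each `m`, `g_m(θ)` has a limit as `θ → π⁻` whose sign is `(-1)^m`. -/
theorem stmt_13 (a : ℝ) (ha1 : -1 ≤ a) (ha2 : a < 1 / 4) :
    (1 : ℝ) ≤ (1 - 2 * a + Real.sqrt (1 - 3 * a)) / (1 - 4 * a) ∧
    Tendsto (zetaFn a) (nhdsWithin Real.pi (Set.Iio Real.pi))
      (nhds ((1 - 2 * a + Real.sqrt (1 - 3 * a)) / (1 - 4 * a))) ∧
    ∀ m : ℕ, ∃ G : ℝ,
      Tendsto (gFn a m) (nhdsWithin Real.pi (Set.Iio Real.pi)) (nhds G) ∧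
      0 < (-1 : ℝ) ^ m * G := by
  have h1 : (1 : ℝ) ≤ (1 - 2 * a + Real.sqrt (1 - 3 * a)) / (1 - 4 * a) := by
    rw [le_div_iff₀ (by linarith)]
    have : -2 * a ≤ Real.sqrt (1 - 3 * a) := by
      apply Real.le_sqrt_of_sq_le
      nlinarith
    linarith
  have hzpi : zetaFn a Real.pi = (1 - 2 * a + Real.sqrt (1 - 3 * a)) / (1 - 4 * a) := by
    unfold zetaFn
    rw [Real.cos_pi]
    congr 1
    · congr 1
      · ring
      · congr 1
        ring
    · ring
  have hc : ContinuousAt (zetaFn a) Real.pi := by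
    unfold zetaFn
    apply ContinuousAt.div
    · fun_prop
    · fun_prop
    · rw [Real.cos_pi]
      intro h
      linarith
  have h2 : Tendsto (zetaFn a) (nhdsWithin Real.pi (Set.Iio Real.pi))
      (nhds ((1 - 2 * a + Real.sqrt (1 - 3 * a)) / (1 - 4 * a))) := by
    rw [← hzpi]
    exact hc.tendsto.mono_left nhdsWithin_le_nhds
  refine ⟨h1, h2, fun m => ?_⟩
  generalize (1 - 2 * a + Real.sqrt (1 - 3 * a)) / (1 - 4 * a) = Z at h1 h2
  have hcos : Tendsto Real.cos (nhdsWithin Real.pi (Set.Iio Real.pi)) (nhds (-1)) := by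
    rw [← Real.cos_pi]
    exact Real.continuous_cos.continuousAt.tendsto.mono_left nhdsWithin_le_nhds
  have hU : Tendsto (fun θ : ℝ => Real.sin ((m + 1) * θ) / Real.sin θ)
      (nhdsWithin Real.pi (Set.Iio Real.pi)) (nhds ((-1) ^ m * (m + 1))) := by
    have hu : Tendsto (fun θ : ℝ => (Polynomial.Chebyshev.U ℝ m).eval (Real.cos θ))
        (nhdsWithin Real.pi (Set.Iio Real.pi)) (nhds ((-1) ^ m * (m + 1))) := by
      have := ((Polynomial.Chebyshev.U ℝ m).continuous.tendsto (-1)).comp hcos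
      rw [Polynomial.Chebyshev.U_eval_neg_one] at this
      simpa [Function.comp_def] using this
    refine hu.congr' ?_
    have hpos : ∀ᶠ θ in nhdsWithin Real.pi (Set.Iio Real.pi), θ ∈ Set.Ioo 0 Real.pi :=
      Ioo_mem_nhdsLT Real.pi_pos
    filter_upwards [hpos] with θ hθ
    rw [eq_div_iff (Real.sin_pos_of_pos_of_lt_pi hθ.1 hθ.2).ne']
    have := Polynomial.Chebyshev.U_real_cos θ m
    simpa using this
  have hcm : Tendsto (fun θ : ℝ => Real.cos ((m + 1) * θ))
      (nhdsWithin Real.pi (Set.Iio Real.pi)) (nhds ((-1) ^ (m + 1))) := by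
    have h : Real.cos ((m + 1) * Real.pi) = (-1) ^ (m + 1) := by
      exact_mod_cast Real.cos_nat_mul_pi (m + 1)
    rw [← h]
    have : Continuous (fun θ : ℝ => Real.cos ((m + 1) * θ)) := by fun_prop
    exact (this.tendsto Real.pi).mono_left nhdsWithin_le_nhds
  have hZ : Z ^ (m + 1) ≠ 0 := by positivity
  refine ⟨(Z - -1) * ((-1) ^ m * (m + 1)) - (-1) ^ (m + 1) + 1 / Z ^ (m + 1), ?_, ?_⟩
  · unfold gFn
    simp only [mul_div_assoc]
    exact (((h2.sub hcos).mul hU).sub hcm).add (tendsto_const_nhds.div (h2.pow _) hZ)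
  · have hi : 1 / Z ^ (m + 1) ≤ 1 := by
      rw [div_le_one (by positivity)]
      exact one_le_pow₀ h1
    have hi0 : 0 < 1 / Z ^ (m + 1) := by positivity
    generalize 1 / Z ^ (m + 1) = w at hi hi0
    have hm : (0 : ℝ) ≤ m := by positivity
    rw [pow_succ]
    rcases neg_one_pow_eq_or ℝ m with h | h <;> rw [h] <;> nlinarith
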